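/- There do not exist five nonempty regular closed subsets r₁,…,r₅ of ℝ² with pairwise disjoint interiors such that each rᵢ has connected interior and each union rᵢ ∪ rⱼ (i ≠ j) has connected interior. -/

import Mathlib

open Complex in
theorem aux_lift {A : Type} [TopologicalSpace A] [SimplyConnectedSpace A]
    [LocallyPathConnectedSpace A] (a₀ : A) (g : A → ℂ) (hg : Continuous g) (h : ∀ a, g a ≠ 0) :
    ∃ F : A → ℂ, Continuous F ∧ ∀ a, exp (F a) = g a := by
  obtain ⟨F, ⟨-, hF⟩, -⟩ := isCoveringMapOn_exp.existsUnique_continuousMap_lifts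
    (f := ⟨g, hg⟩) (a₀ := a₀) (e₀ := log (g a₀)) (exp_log (h a₀)) (by simpa using h)
  exact ⟨F, F.continuous, fun a => congrFun hF a⟩

open Complex in
theorem aux_uniq (L M : ℝ → ℂ) (hL : Continuous L) (hM : Continuous M)
    (h : ∀ t, exp (L t) = exp (M t)) : L 1 - L 0 = M 1 - M 0 := by
  obtain ⟨F, -, hF⟩ := isCoveringMapOn_exp.existsUnique_continuousMap_lifts
    (f := ⟨fun t => exp (L t), by fun_prop⟩) (a₀ := (0 : ℝ)) (e₀ := L 0) rfl (by simp)
  have h1 := hF ⟨L, hL⟩ ⟨rfl, rfl⟩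
  have h2 := hF ⟨fun t => M t + (L 0 - M 0), by fun_prop⟩ ⟨by simp, by
    funext t
    simp [exp_add, exp_sub, h]⟩
  have := congrArg (fun f : C(ℝ, ℂ) => f 1) (h1.trans h2.symm)
  simp only [ContinuousMap.coe_mk] at this
  rw [this]; ring

/-- sign of an ordered pair -/
def auxS (x y : Fin 5) : ℤ := if x < y then -1 else 1

open Complex in
theorem aux_k5 (p : Fin 5 → ℂ) (hp : ∀ a b, a ≠ b → p a ≠ p b)
    (γ : Fin 5 → Fin 5 → ℝ → ℂ) (hc : ∀ a b, a < b → Continuous (γ a b))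
    (h0 : ∀ a b, a < b → γ a b 0 = p a) (h1 : ∀ a b, a < b → γ a b 1 = p b)
    (hv : ∀ a b c, a < b → c ≠ a → c ≠ b → ∀ t, γ a b t ≠ p c)
    (he : ∀ a b c d, a < b → c < d → a ≠ c → a ≠ d → b ≠ c → b ≠ d →
      ∀ s t, γ a b s ≠ γ c d t) : False := by
  -- logarithms of directions
  obtain ⟨A, hA, hAs⟩ : ∃ A : Fin 5 → Fin 5 → ℂ, (∀ a b, a ≠ b → exp (A a b) = p b - p a) ∧
      ∀ a b, a ≠ b → A a b - A b a = Real.pi * I * auxS a b := by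
    refine ⟨fun a b => if a < b then log (p b - p a) else log (p a - p b) + Real.pi * I, ?_, ?_⟩
    · intro a b hab
      have h1 := sub_ne_zero.2 (hp a b hab)
      have h2 := sub_ne_zero.2 (hp b a hab.symm)
      by_cases h : a < b
      · simp [h, exp_log h2]
      · simp [h, exp_add, exp_log h1]
    · intro a b hab
      rcases lt_or_gt_of_ne hab with h | h
      · simp [h, h.not_gt, auxS]
      · simp [h, h.not_gt, auxS]
  have hθ : ∀ v a b : Fin 5, ∃ n : ℤ, a < b → v ≠ a → v ≠ b →
      ∀ L : ℝ → ℂ, Continuous L → (∀ t, exp (L t) = γ a b t - p v) →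
        L 1 - L 0 = A v b - A v a + n * (2 * Real.pi * I) := by
    intro v a b
    by_cases h : a < b ∧ v ≠ a ∧ v ≠ b
    · obtain ⟨hab, hva, hvb⟩ := h
      obtain ⟨M, hM, hMe⟩ := aux_lift (0 : ℝ) (fun t => γ a b t - p v)
        ((hc a b hab).sub continuous_const) (fun t => sub_ne_zero.2 (hv a b v hab hva hvb t))
      obtain ⟨n1, e1⟩ := exp_eq_exp_iff_exists_int.1
        ((hMe 1).trans (by simp only [h1 a b hab]; exact (hA v b hvb).symm))
      obtain ⟨n0, e0⟩ := exp_eq_exp_iff_exists_int.1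
        ((hMe 0).trans (by simp only [h0 a b hab]; exact (hA v a hva).symm))
      refine ⟨n1 - n0, fun _ _ _ L hL hLe => ?_⟩
      rw [aux_uniq L M hL hM (fun t => (hLe t).trans (hMe t).symm), e1, e0]
      push_cast; ring
    · exact ⟨0, fun x y z => absurd ⟨x, y, z⟩ h⟩
  choose n hn using hθ
  have key : ∀ a b c d : Fin 5, a < b → c < d → a ≠ c → a ≠ d → b ≠ c → b ≠ d →
      auxS c b + auxS a c + auxS b d + auxS d a
        + 2 * (n c a b + n b c d - n d a b - n a c d) = 0 := by
    intro a b c d hab hcd hac had hbc hbd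
    have hc1 := hc a b hab
    have hc2 := hc c d hcd
    obtain ⟨F, hF, hFe⟩ := aux_lift ((0, 0) : ℝ × ℝ) (fun x => γ a b x.1 - γ c d x.2)
      (by fun_prop) (fun x => sub_ne_zero.2 (he a b c d hab hcd hac had hbc hbd _ _))
    have e1 := hn c a b hab hac.symm hbc.symm (fun s => F (s, 0)) (by fun_prop)
      (fun t => by rw [hFe]; simp only [h0 c d hcd])
    have e2 := hn d a b hab had.symm hbd.symm (fun s => F (s, 1)) (by fun_prop)
      (fun t => by rw [hFe]; simp only [h1 c d hcd])
    have e3 := hn b c d hcd hbc hbd (fun t => F (1, t) + Real.pi * I) (by fun_prop)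
      (fun t => by rw [exp_add, hFe]; simp only [h1 a b hab, exp_pi_mul_I]; ring)
    have e4 := hn a c d hcd hac had (fun t => F (0, t) + Real.pi * I) (by fun_prop)
      (fun t => by rw [exp_add, hFe]; simp only [h0 a b hab, exp_pi_mul_I]; ring)
    have s1 := hAs c b hbc.symm
    have s2 := hAs a c hac
    have s3 := hAs b d hbd
    have s4 := hAs d a had.symm
    have hpi : (Real.pi * I : ℂ) ≠ 0 := by simp [Real.pi_ne_zero]
    have : (Real.pi * I : ℂ) * ((auxS c b + auxS a c + auxS b d + auxS d a
        + 2 * (n c a b + n b c d - n d a b - n a c d) : ℤ) : ℂ) = 0 := by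
      push_cast
      linear_combination -s1 - s2 - s3 - s4 - e1 - e3 + e2 + e4
    exact_mod_cast (mul_eq_zero.1 this).resolve_left hpi
  have k1 := key 0 1 2 3 (by decide) (by decide) (by decide) (by decide) (by decide) (by decide)
  have k2 := key 0 2 1 3 (by decide) (by decide) (by decide) (by decide) (by decide) (by decide)
  have k3 := key 0 3 1 2 (by decide) (by decide) (by decide) (by decide) (by decide) (by decide)
  have k4 := key 0 1 2 4 (by decide) (by decide) (by decide) (by decide) (by decide) (by decide)
  have k5 := key 0 2 1 4 (by decide) (by decide) (by decide) (by decide) (by decide) (by decide)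
  have k6 := key 0 4 1 2 (by decide) (by decide) (by decide) (by decide) (by decide) (by decide)
  have k7 := key 0 1 3 4 (by decide) (by decide) (by decide) (by decide) (by decide) (by decide)
  have k8 := key 0 3 1 4 (by decide) (by decide) (by decide) (by decide) (by decide) (by decide)
  have k9 := key 0 4 1 3 (by decide) (by decide) (by decide) (by decide) (by decide) (by decide)
  have k10 := key 0 2 3 4 (by decide) (by decide) (by decide) (by decide) (by decide) (by decide)
  have k11 := key 0 3 2 4 (by decide) (by decide) (by decide) (by decide) (by decide) (by decide)
  have k12 := key 0 4 2 3 (by decide) (by decide) (by decide) (by decide) (by decide) (by decide)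
  have k13 := key 1 2 3 4 (by decide) (by decide) (by decide) (by decide) (by decide) (by decide)
  have k14 := key 1 3 2 4 (by decide) (by decide) (by decide) (by decide) (by decide) (by decide)
  have k15 := key 1 4 2 3 (by decide) (by decide) (by decide) (by decide) (by decide) (by decide)
  simp [auxS] at k1 k2 k3 k4 k5 k6 k7 k8 k9 k10 k11 k12 k13 k14 k15
  omega

/-- There do not exist five nonempty regular closed subsets of `ℝ²` with pairwise disjoint
interiors, each with connected interior, such that every pairwise union has connected
interior. -/
theorem no_five_interior_connected_contact_in_plane :
    ¬ ∃ r : Fin 5 → Set (Fin 2 → ℝ),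
      (∀ i, r i = closure (interior (r i))) ∧
      (∀ i, (r i).Nonempty) ∧
      (∀ i j, i ≠ j → interior (r i) ∩ interior (r j) = ∅) ∧
      (∀ i, IsConnected (interior (r i))) ∧
      (∀ i j, i ≠ j → IsConnected (interior (r i ∪ r j))) := by
  rintro ⟨r, hr, -, hd, hcn, hu⟩
  choose q hq using fun i => (hcn i).nonempty
  -- an open set disjoint from the interior is disjoint from the set
  have hdis : ∀ i j, i ≠ j → Disjoint (interior (r i)) (r j) := by
    intro i j hij
    rw [hr j]
    exact (Set.disjoint_iff_inter_eq_empty.2 (hd i j hij)).closure_right isOpen_interior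
  have hvW : ∀ a b c, c ≠ a → c ≠ b → Disjoint (interior (r c)) (r a ∪ r b) := by
    intro a b c hca hcb
    exact Set.disjoint_union_right.2 ⟨hdis c a hca, hdis c b hcb⟩
  have hWW : ∀ a b c d, a ≠ c → a ≠ d → b ≠ c → b ≠ d →
      Disjoint (interior (r a ∪ r b)) (interior (r c ∪ r d)) := by
    intro a b c d hac had hbc hbd
    have h1 : Disjoint (r a) (interior (r c ∪ r d)) := by
      rw [hr a]
      exact ((hvW c d a hac had).mono_right interior_subset).closure_left isOpen_interior
    have h2 : Disjoint (r b) (interior (r c ∪ r d)) := by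
      rw [hr b]
      exact ((hvW c d b hbc hbd).mono_right interior_subset).closure_left isOpen_interior
    exact (Set.disjoint_union_left.2 ⟨h1, h2⟩).mono_left interior_subset
  have hpath : ∀ a b, ∃ g : ℝ → (Fin 2 → ℝ), a < b → Continuous g ∧ g 0 = q a ∧ g 1 = q b ∧
      ∀ t, g t ∈ interior (r a ∪ r b) := by
    intro a b
    by_cases hab : a < b
    · have hpc := (isOpen_interior.isConnected_iff_isPathConnected).1 (hu a b hab.ne)
      obtain ⟨P, hP⟩ := hpc.joinedIn (q a) (interior_mono Set.subset_union_left (hq a))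
        (q b) (interior_mono Set.subset_union_right (hq b))
      refine ⟨P.extend, fun _ => ⟨P.continuous_extend, by simp, by simp, fun t => ?_⟩⟩
      exact hP (Set.projIcc 0 1 zero_le_one t)
    · exact ⟨fun _ => 0, fun h => absurd h hab⟩
  choose g hg using hpath
  let φ : (Fin 2 → ℝ) → ℂ := fun x => ⟨x 0, x 1⟩
  have hφc : Continuous φ := by
    have : φ = fun x => (x 0 : ℂ) + x 1 * Complex.I := by
      funext x; exact Complex.mk_eq_add_mul_I _ _
    rw [this]; fun_prop
  have hφi : ∀ x y, φ x = φ y → x = y := by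
    intro x y h
    have h0 := congrArg Complex.re h
    have h1 := congrArg Complex.im h
    funext i
    fin_cases i
    · exact h0
    · exact h1
  refine aux_k5 (fun a => φ (q a)) ?_ (fun a b t => φ (g a b t)) ?_ ?_ ?_ ?_ ?_
  · intro a b hab h
    exact Set.disjoint_left.1 (hdis a b hab) (hq a) (hφi _ _ h ▸ interior_subset (hq b))
  · intro a b hab
    exact hφc.comp (hg a b hab).1
  · intro a b hab
    exact congrArg φ (hg a b hab).2.1
  · intro a b hab
    exact congrArg φ (hg a b hab).2.2.1
  · intro a b c hab hca hcb t h
    exact Set.disjoint_left.1 (hvW a b c hca hcb) (hq c)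
      (hφi _ _ h ▸ interior_subset ((hg a b hab).2.2.2 t))
  · intro a b c d hab hcd hac had hbc hbd s t h
    exact Set.disjoint_left.1 (hWW a b c d hac had hbc hbd) ((hg a b hab).2.2.2 s)
      (hφi _ _ h ▸ (hg c d hcd).2.2.2 t)
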